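/- arXiv:2412.17642 — 2 statements merged into one kernel-verified Lean document; each statement's English description precedes it below -/
import Mathlib

section
/- A connected graph G is an arborescence if and only if G is a C4-free and P4-free treelike comparability graph. -/
/-- A strict partial order (irreflexive and transitive relation). -/
def IsStrictPO {V : Type*} (lt : V → V → Prop) : Prop :=
  (∀ a, ¬ lt a a) ∧ ∀ a b c, lt a b → lt b c → lt a c

/-- `b` covers `a` in the strict order `lt`. -/
def CovRel {V : Type*} (lt : V → V → Prop) (a b : V) : Prop :=
  lt a b ∧ ∀ c, lt a c → ¬ lt c b

/-- The Hasse diagram of a strict order: vertices joined iff one covers the other. -/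
def hasseGraph {V : Type*} (lt : V → V → Prop) : SimpleGraph V :=
  SimpleGraph.fromRel (CovRel lt)

/-- `lt` is a treelike orientation of `G`: a transitive orientation
(a strict partial order in which distinct vertices are adjacent iff comparable)
whose Hasse diagram is a tree. -/
def IsTreelikeOrientation {V : Type*} (G : SimpleGraph V) (lt : V → V → Prop) : Prop :=
  IsStrictPO lt ∧ (∀ a b : V, G.Adj a b ↔ (lt a b ∨ lt b a)) ∧ (hasseGraph lt).IsTree

/-- A treelike comparability graph: a graph admitting a treelike orientation. -/
def IsTreelikeComparability {V : Type*} (G : SimpleGraph V) : Prop :=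
  ∃ lt : V → V → Prop, IsTreelikeOrientation G lt

/-- A double-arborescence: a treelike comparability graph with an all-adjacent vertex. -/
def IsDoubleArborescence {V : Type*} (G : SimpleGraph V) : Prop :=
  IsTreelikeComparability G ∧ ∃ r : V, ∀ v : V, v ≠ r → G.Adj r v

/-- An arborescence: a treelike comparability graph admitting a treelike orientation
in which some vertex is the greatest or the least element. -/
def IsArborescence {V : Type*} (G : SimpleGraph V) : Prop :=
  ∃ lt : V → V → Prop, IsTreelikeOrientation G lt ∧
    ∃ r : V, (∀ v : V, v ≠ r → lt v r) ∨ (∀ v : V, v ≠ r → lt r v)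

/-- `G` contains an induced path on four vertices. -/
def HasInducedP4 {V : Type*} (G : SimpleGraph V) : Prop :=
  ∃ a b c d : V, a ≠ b ∧ a ≠ c ∧ a ≠ d ∧ b ≠ c ∧ b ≠ d ∧ c ≠ d ∧
    G.Adj a b ∧ G.Adj b c ∧ G.Adj c d ∧ ¬ G.Adj a c ∧ ¬ G.Adj a d ∧ ¬ G.Adj b d

/-- `G` is `P4`-free. -/
def P4Free {V : Type*} (G : SimpleGraph V) : Prop := ¬ HasInducedP4 G

/-- `G` contains an induced cycle on four vertices. -/
def HasInducedC4 {V : Type*} (G : SimpleGraph V) : Prop :=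
  ∃ a b c d : V, a ≠ b ∧ a ≠ c ∧ a ≠ d ∧ b ≠ c ∧ b ≠ d ∧ c ≠ d ∧
    G.Adj a b ∧ G.Adj b c ∧ G.Adj c d ∧ G.Adj d a ∧ ¬ G.Adj a c ∧ ¬ G.Adj b d

/-- `G` is `C4`-free. -/
def C4Free {V : Type*} (G : SimpleGraph V) : Prop := ¬ HasInducedC4 G

namespace IsStrictPO

variable {V : Type*} {lt : V → V → Prop}

theorem swap (h : IsStrictPO lt) : IsStrictPO (fun a b => lt b a) :=
  ⟨h.1, fun a b c hab hbc => h.2 c b a hbc hab⟩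

theorem wellFounded [Finite V] (h : IsStrictPO lt) : WellFounded lt := by
  have : Std.Irrefl lt := ⟨h.1⟩
  have : IsTrans V lt := ⟨h.2⟩
  exact Finite.wellFounded_of_trans_of_irrefl lt

theorem exists_covRel [Finite V] (h : IsStrictPO lt) {x y : V} (hxy : lt x y) :
    ∃ c, CovRel lt x c ∧ (c = y ∨ lt c y) := by
  obtain ⟨c, ⟨hxc, hcy⟩, hmin⟩ :=
    h.wellFounded.has_min {c | lt x c ∧ (c = y ∨ lt c y)} ⟨y, hxy, Or.inl rfl⟩
  refine ⟨c, ⟨hxc, fun d hxd hdc => hmin d ⟨hxd, Or.inr ?_⟩ hdc⟩, hcy⟩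
  rcases hcy with rfl | hcy
  · exact hdc
  · exact h.2 _ _ _ hdc hcy

theorem hasseGraph_adj (h : IsStrictPO lt) {a b : V} :
    (hasseGraph lt).Adj a b ↔ CovRel lt a b ∨ CovRel lt b a := by
  rw [hasseGraph, SimpleGraph.fromRel_adj]
  refine ⟨fun hab => hab.2, fun hab => ⟨?_, hab⟩⟩
  rintro rfl
  rcases hab with hab | hab <;> exact h.1 _ hab.1

/-- The map sending each element of `s` to the Hasse edge joining it to a chosen cover
is injective. -/
theorem injective_cover_edge (h : IsStrictPO lt) {s : Set V} {p : s → V}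
    (hp : ∀ v : s, CovRel lt v (p v)) :
    Function.Injective fun v : s =>
      (⟨s((v : V), p v), h.hasseGraph_adj.2 (Or.inl (hp v))⟩ : (hasseGraph lt).edgeSet) := by
  intro v w hvw
  rcases Sym2.eq_iff.1 (congrArg Subtype.val hvw) with ⟨hv, -⟩ | ⟨hv, hw⟩
  · exact Subtype.ext hv
  · have h₁ := (hp v).1
    have h₂ := (hp w).1
    rw [hw] at h₁
    rw [← hv] at h₂
    exact (h.1 _ (h.2 _ _ _ h₁ h₂)).elim

theorem exists_cover_choice [Finite V] (h : IsStrictPO lt) {r : V}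
    (hr : ∀ v, v ≠ r → lt v r) :
    ∃ p : ({r}ᶜ : Set V) → V, ∀ v : ({r}ᶜ : Set V), CovRel lt v (p v) := by
  have key (v : ({r}ᶜ : Set V)) : ∃ c, CovRel lt v c :=
    let ⟨c, hc, _⟩ := h.exists_covRel (hr v v.2)
    ⟨c, hc⟩
  exact ⟨fun v => (key v).choose, fun v => (key v).choose_spec⟩

theorem covRel_unique_of_isTree [Finite V] (h : IsStrictPO lt)
    (ht : (hasseGraph lt).IsTree) {r : V} (hr : ∀ v, v ≠ r → lt v r) {x a b : V}
    (ha : CovRel lt x a) (hb : CovRel lt x b) : a = b := by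
  obtain ⟨p, hp⟩ := h.exists_cover_choice hr
  have hcard : Nat.card (hasseGraph lt).edgeSet ≤ Nat.card ({r}ᶜ : Set V) := by
    have h₁ := (SimpleGraph.isTree_iff_connected_and_card.1 ht).2
    have h₂ := Set.ncard_add_ncard_compl ({r} : Set V)
    rw [Set.ncard_singleton] at h₂
    rw [Nat.card_coe_set_eq ({r}ᶜ : Set V)]
    omega
  have hsurj := ((h.injective_cover_edge hp).bijective_of_nat_card_le hcard).2
  have key (c : V) (hc : CovRel lt x c) (hx : x ∈ ({r}ᶜ : Set V)) : c = p ⟨x, hx⟩ := by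
    obtain ⟨w, hw⟩ := hsurj ⟨s(x, c), h.hasseGraph_adj.2 (Or.inl hc)⟩
    rcases Sym2.eq_iff.1 (congrArg Subtype.val hw) with ⟨rfl, hpw⟩ | ⟨rfl, hpw⟩
    · exact hpw.symm
    · have h₁ := (hp w).1
      rw [hpw] at h₁
      exact (h.1 _ (h.2 _ _ _ h₁ hc.1)).elim
  have hx : x ∈ ({r}ᶜ : Set V) := by
    rintro rfl
    exact h.1 _ (h.2 _ _ _ ha.1 (hr a fun e => h.1 _ (e ▸ ha.1)))
  rw [key a ha hx, key b hb hx]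

theorem comparable_of_covRel_unique [Finite V] (h : IsStrictPO lt)
    (hu : ∀ x a b, CovRel lt x a → CovRel lt x b → a = b) (x : V) :
    ∀ y z, lt x y → lt x z → y = z ∨ lt y z ∨ lt z y := by
  induction x using h.swap.wellFounded.induction with
  | _ x ih =>
    intro y z hy hz
    obtain ⟨c, hc, hcy⟩ := h.exists_covRel hy
    obtain ⟨d, hd, hdz⟩ := h.exists_covRel hz
    obtain rfl := hu x c d hc hd
    rcases hcy with rfl | hcy
    · exact hdz.imp_right Or.inl
    rcases hdz with rfl | hdz
    · exact Or.inr (Or.inr hcy)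
    exact ih c hc.1 y z hcy hdz

theorem isTree_hasseGraph [Finite V] (h : IsStrictPO lt) {r : V}
    (hr : ∀ v, v ≠ r → lt v r)
    (hchain : ∀ x y z, lt x y → lt x z → y = z ∨ lt y z ∨ lt z y) :
    (hasseGraph lt).IsTree := by
  obtain ⟨p, hp⟩ := h.exists_cover_choice hr
  have hreach (x : V) : (hasseGraph lt).Reachable x r := by
    induction x using h.swap.wellFounded.induction with
    | _ x ih =>
      by_cases hx : x = r
      · rw [hx]
      · have hc := hp ⟨x, hx⟩
        exact (h.hasseGraph_adj.2 (Or.inl hc)).reachable.trans (ih _ hc.1)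
  have hconn : (hasseGraph lt).Connected :=
    { preconnected := fun x y => (hreach x).trans (hreach y).symm
      nonempty := ⟨r⟩ }
  have hu (x a b : V) (ha : CovRel lt x a) (hb : CovRel lt x b) : a = b := by
    rcases hchain x a b ha.1 hb.1 with hab | hab | hab
    · exact hab
    · exact (hb.2 a ha.1 hab).elim
    · exact (ha.2 b hb.1 hab).elim
  have hsurj : Function.Surjective fun v : ({r}ᶜ : Set V) =>
      (⟨s((v : V), p v), h.hasseGraph_adj.2 (Or.inl (hp v))⟩ : (hasseGraph lt).edgeSet) := by
    have key (a b : V) (hab : CovRel lt a b) :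
        ∃ v : ({r}ᶜ : Set V), s((v : V), p v) = s(a, b) := by
      have ha : a ∈ ({r}ᶜ : Set V) := by
        rintro rfl
        exact h.1 _ (h.2 _ _ _ hab.1 (hr b fun e => h.1 _ (e ▸ hab.1)))
      exact ⟨⟨a, ha⟩, by rw [hu a _ _ (hp ⟨a, ha⟩) hab]⟩
    rintro ⟨e, he⟩
    induction e using Sym2.ind with
    | _ a b =>
      rcases h.hasseGraph_adj.1 he with hab | hab
      · obtain ⟨v, hv⟩ := key a b hab
        exact ⟨v, Subtype.ext hv⟩
      · obtain ⟨v, hv⟩ := key b a hab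
        exact ⟨v, Subtype.ext (hv.trans Sym2.eq_swap)⟩
  refine SimpleGraph.isTree_iff_connected_and_card.2 ⟨hconn, ?_⟩
  have h₁ : Nat.card (hasseGraph lt).edgeSet ≤ Nat.card ({r}ᶜ : Set V) :=
    Nat.card_le_card_of_surjective _ hsurj
  have h₂ := Set.ncard_add_ncard_compl ({r} : Set V)
  have h₃ := hconn.card_vert_le_card_edgeSet_add_one
  rw [Set.ncard_singleton] at h₂
  rw [Nat.card_coe_set_eq ({r}ᶜ : Set V)] at h₁
  omega

end IsStrictPO

theorem hasseGraph_swap {V : Type*} (lt : V → V → Prop) :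
    hasseGraph (fun a b => lt b a) = hasseGraph lt := by
  have key (a b : V) : CovRel (fun a b => lt b a) a b ↔ CovRel lt b a :=
    and_congr_right fun _ => ⟨fun h c hc hc' => h c hc' hc, fun h c hc hc' => h c hc' hc⟩
  ext a b
  simp only [hasseGraph, SimpleGraph.fromRel_adj, key, or_comm]

theorem IsTreelikeOrientation.swap {V : Type*} {G : SimpleGraph V} {lt : V → V → Prop}
    (h : IsTreelikeOrientation G lt) : IsTreelikeOrientation G (fun a b => lt b a) :=
  ⟨h.1.swap, fun a b => (h.2.1 a b).trans or_comm, (hasseGraph_swap lt).symm ▸ h.2.2⟩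

theorem IsArborescence.exists_greatest {V : Type*} {G : SimpleGraph V}
    (h : IsArborescence G) :
    ∃ lt : V → V → Prop, IsTreelikeOrientation G lt ∧ ∃ r, ∀ v, v ≠ r → lt v r := by
  obtain ⟨lt, hlt, r, hr | hr⟩ := h
  · exact ⟨lt, hlt, r, hr⟩
  · exact ⟨_, hlt.swap, r, hr⟩

/-- A path `a b c d` in an arborescence has the chord `ac` or the chord `bd`. -/
theorem IsArborescence.adj_or_adj {V : Type*} [Finite V] {G : SimpleGraph V}
    (h : IsArborescence G) {a b c d : V} (hac : a ≠ c) (hbd : b ≠ d)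
    (hab : G.Adj a b) (hbc : G.Adj b c) (hcd : G.Adj c d) : G.Adj a c ∨ G.Adj b d := by
  obtain ⟨lt, ⟨hpo, hadj, htree⟩, r, hr⟩ := h.exists_greatest
  have hchain := hpo.comparable_of_covRel_unique
    fun _ _ _ => hpo.covRel_unique_of_isTree htree hr
  have key {x y z : V} (hxz : x ≠ z) (hxy : G.Adj x y) (hyz : lt y z) : G.Adj x z := by
    rcases (hadj x y).1 hxy with hxy | hxy
    · exact (hadj x z).2 (Or.inl (hpo.2 _ _ _ hxy hyz))
    · exact (hadj x z).2 ((hchain y x z hxy hyz).resolve_left hxz)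
  rcases (hadj b c).1 hbc with hbc | hbc
  · exact Or.inl (key hac hab hbc)
  · exact Or.inr (key hbd.symm hcd.symm hbc).symm

/-- In a graph without induced `C4` and `P4`, the closed neighborhoods of adjacent
vertices are nested. -/
theorem insert_neighborSet_subset_or_subset {V : Type*} {G : SimpleGraph V}
    (hC : C4Free G) (hP : P4Free G) {a b : V} (hab : G.Adj a b) :
    insert a (G.neighborSet a) ⊆ insert b (G.neighborSet b) ∨
      insert b (G.neighborSet b) ⊆ insert a (G.neighborSet a) := by
  by_contra! hcon
  obtain ⟨⟨x, hxa, hxb⟩, ⟨y, hyb, hya⟩⟩ := hcon.imp Set.not_subset.1 Set.not_subset.1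
  simp only [Set.mem_insert_iff, SimpleGraph.mem_neighborSet, not_or] at hxa hxb hyb hya
  have hax : G.Adj a x := hxa.resolve_left fun e => hxb.2 (e ▸ hab.symm)
  have hby : G.Adj b y := hyb.resolve_left fun e => hya.2 (e ▸ hab)
  have hxy : x ≠ y := fun e => hya.2 (e ▸ hax)
  by_cases hyx : G.Adj y x
  · exact hC ⟨x, a, b, y, hax.ne', hxb.1, hxy, hab.ne, Ne.symm hya.1, hby.ne,
      hax.symm, hab, hby, hyx, fun e => hxb.2 e.symm, hya.2⟩
  · exact hP ⟨x, a, b, y, hax.ne', hxb.1, hxy, hab.ne, Ne.symm hya.1, hby.ne,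
      hax.symm, hab, hby, fun e => hxb.2 e.symm, fun e => hyx e.symm, hya.2⟩

/-- A connected graph without induced `C4` and `P4` is an arborescence: orient its edges
by inclusion of closed neighborhoods, breaking ties by a linear order. -/
theorem isArborescence_of_C4Free_P4Free {V : Type*} [Finite V] {G : SimpleGraph V}
    (hconn : G.Connected) (hC : C4Free G) (hP : P4Free G) : IsArborescence G := by
  obtain ⟨n, ⟨e⟩⟩ := Finite.exists_equiv_fin V
  let N : V → Set V := fun v => insert v (G.neighborSet v)
  have mem_N {v w : V} : w ∈ N v ↔ w = v ∨ G.Adj v w := Iff.rfl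
  let lt : V → V → Prop := fun a b => G.Adj a b ∧ N a ⊆ N b ∧ (N b ⊆ N a → e a < e b)
  have hadj (a b : V) : G.Adj a b ↔ lt a b ∨ lt b a := by
    refine ⟨fun hab => ?_, fun h => h.elim (fun h => h.1) fun h => h.1.symm⟩
    have hne : e a ≠ e b := fun h => hab.ne (e.injective h)
    rcases insert_neighborSet_subset_or_subset hC hP hab with h | h
    · by_cases h' : N b ⊆ N a
      · rcases lt_or_gt_of_ne hne with hlt | hlt
        · exact Or.inl ⟨hab, h, fun _ => hlt⟩
        · exact Or.inr ⟨hab.symm, h', fun _ => hlt⟩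
      · exact Or.inl ⟨hab, h, fun h'' => (h' h'').elim⟩
    · by_cases h' : N a ⊆ N b
      · rcases lt_or_gt_of_ne hne with hlt | hlt
        · exact Or.inl ⟨hab, h', fun _ => hlt⟩
        · exact Or.inr ⟨hab.symm, h, fun _ => hlt⟩
      · exact Or.inr ⟨hab.symm, h, fun h'' => (h' h'').elim⟩
  have hpo : IsStrictPO lt := by
    refine ⟨fun a h => G.irrefl h.1, fun a b c hab hbc => ?_⟩
    have hlt (h : N c ⊆ N a) : e a < e c :=
      (hab.2.2 (hbc.2.1.trans h)).trans (hbc.2.2 (h.trans hab.2.1))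
    have hac : a ∈ N c := hbc.2.1 (hab.2.1 (mem_N.2 (Or.inl rfl)))
    refine ⟨((mem_N.1 hac).resolve_left ?_).symm, hab.2.1.trans hbc.2.1, hlt⟩
    rintro rfl
    exact lt_irrefl _ (hlt subset_rfl)
  have hchain (x y z : V) (hy : lt x y) (hz : lt x z) : y = z ∨ lt y z ∨ lt z y := by
    rw [← hadj]
    exact (mem_N.1 (hz.2.1 (mem_N.2 (Or.inr hy.1)))).imp_right fun h => h.symm
  have := hconn.nonempty
  obtain ⟨r, -, hmax⟩ := hpo.swap.wellFounded.has_min Set.univ Set.univ_nonempty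
  have hr (v : V) : v = r ∨ lt v r := by
    obtain ⟨w⟩ := hconn.preconnected v r
    induction w with
    | nil => exact Or.inl rfl
    | @cons u v w huv _ ih =>
      have ih := ih hmax
      rcases ih with rfl | ih
      · exact Or.inr (((hadj _ _).1 huv).resolve_right (hmax _ trivial))
      · rcases (hadj _ _).1 huv with huv | hvu
        · exact Or.inr (hpo.2 _ _ _ huv ih)
        · exact (hchain _ _ _ hvu ih).imp_right fun h => h.resolve_right (hmax _ trivial)
  have hr' (v : V) (hv : v ≠ r) : lt v r := (hr v).resolve_left hv
  exact ⟨lt, ⟨hpo, hadj, hpo.isTree_hasseGraph hr' hchain⟩, r, Or.inl hr'⟩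

/-- A connected graph is an arborescence iff it is a `C4`-free and `P4`-free
treelike comparability graph. -/
theorem arborescence_iff_C4Free_P4Free_treelike
    {V : Type*} [Fintype V] (G : SimpleGraph V) (hconn : G.Connected) :
    IsArborescence G ↔ (C4Free G ∧ P4Free G ∧ IsTreelikeComparability G) := by
  refine ⟨fun h => ⟨?_, ?_, ?_⟩, fun h => isArborescence_of_C4Free_P4Free hconn h.1 h.2.1⟩
  · rintro ⟨a, b, c, d, -, hac, -, -, hbd, -, hab, hbc, hcd, -, hnac, hnbd⟩
    exact (h.adj_or_adj hac hbd hab hbc hcd).elim hnac hnbd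
  · rintro ⟨a, b, c, d, -, hac, -, -, hbd, -, hab, hbc, hcd, hnac, -, hnbd⟩
    exact (h.adj_or_adj hac hbd hab hbc hcd).elim hnac hnbd
  · obtain ⟨lt, hlt, -⟩ := h
    exact ⟨lt, hlt⟩
end

section
/- Let G = (V, E) be an arborescence, let ≺ be a treelike orientation of G whose greatest element is r, and let C be a maximum clique of G with r ∈ C. Then there exist words w1 and w2 over V such that the concatenated word w = w1 r w2 represents G, every vertex of C occurs exactly once in w (the vertices of C ∖ {r} occurring in w1), and every vertex of V ∖ C occurs exactly once in w1 and exactly once in w2. -/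
/-- Two distinct letters `a` and `b` alternate in the word `w`: the subsequence of `w`
consisting of all occurrences of `a` and `b` has no two consecutive equal letters. -/
def Alternates {V : Type*} [DecidableEq V] (w : List V) (a b : V) : Prop :=
  (w.filter (fun x => decide (x = a ∨ x = b))).Chain' (· ≠ ·)

/-- The word `w` represents the graph `G`: every vertex occurs in `w`, and distinct
vertices are adjacent iff they alternate in `w`. -/
def Represents {V : Type*} [DecidableEq V] (G : SimpleGraph V) (w : List V) : Prop :=
  (∀ v : V, v ∈ w) ∧ ∀ a b : V, a ≠ b → (G.Adj a b ↔ Alternates w a b)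

/-- The word `w`, whose letters all lie in `S`, represents the induced subgraph `G[S]`. -/
def RepresentsOn {V : Type*} [DecidableEq V] (G : SimpleGraph V) (S : Set V)
    (w : List V) : Prop :=
  (∀ x ∈ w, x ∈ S) ∧ (∀ v ∈ S, v ∈ w) ∧
    ∀ a ∈ S, ∀ b ∈ S, a ≠ b → (G.Adj a b ↔ Alternates w a b)

lemma exists_walk_pairwise_lt {V : Type*} [Finite V] {lt : V → V → Prop} (h : IsStrictPO lt)
    (a b : V) (hab : a = b ∨ lt a b) :
    ∃ p : (hasseGraph lt).Walk a b, p.support.Pairwise lt ∧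
      ∀ x ∈ p.support, x = b ∨ lt x b := by
  obtain ⟨hirr, htrans⟩ := h
  have : IsTrans V (Function.swap lt) := ⟨fun a b c h1 h2 => htrans c b a h2 h1⟩
  have : Std.Irrefl (Function.swap lt) := ⟨hirr⟩
  have : IsTrans V lt := ⟨htrans⟩
  have : Std.Irrefl lt := ⟨hirr⟩
  have wf : WellFounded (Function.swap lt) := Finite.wellFounded_of_trans_of_irrefl _
  have wf' : WellFounded lt := Finite.wellFounded_of_trans_of_irrefl _
  induction a using wf.induction with
  | _ a ih =>
  rcases hab with rfl | hab
  · exact ⟨.nil, by simp, by simp⟩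
  obtain ⟨c, ⟨hac, hcb⟩, hmin⟩ :=
    wf'.has_min {c | lt a c ∧ (c = b ∨ lt c b)} ⟨b, hab, .inl rfl⟩
  have hcov : CovRel lt a c := by
    refine ⟨hac, fun d had hdc => hmin d ⟨had, ?_⟩ hdc⟩
    rcases hcb with rfl | hcb
    · exact .inr hdc
    · exact .inr (htrans _ _ _ hdc hcb)
  have hadj : (hasseGraph lt).Adj a c := by
    rw [hasseGraph, SimpleGraph.fromRel_adj]
    exact ⟨fun e => hirr c (e ▸ hac), .inl hcov⟩
  obtain ⟨q, hq, hqb⟩ := ih c hac hcb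
  refine ⟨.cons hadj q, ?_, ?_⟩
  · rw [SimpleGraph.Walk.support_cons, List.pairwise_cons]
    refine ⟨fun x hx => ?_, hq⟩
    rw [← SimpleGraph.Walk.cons_tail_support] at hx hq
    rcases List.mem_cons.1 hx with rfl | hx
    · exact hac
    · exact htrans _ _ _ hac ((List.pairwise_cons.1 hq).1 x hx)
  · intro x hx
    rw [SimpleGraph.Walk.support_cons] at hx
    rcases List.mem_cons.1 hx with rfl | hx
    · exact .inr hab
    · exact hqb x hx

lemma exists_isPath_through {V : Type*} [Finite V] {lt : V → V → Prop} (h : IsStrictPO lt)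
    {a b r : V} (hab : lt a b) (hbr : b = r ∨ lt b r) :
    ∃ p : (hasseGraph lt).Walk a r, p.IsPath ∧ p.support.Pairwise lt ∧ b ∈ p.support := by
  obtain ⟨p, hp, hpb⟩ := exists_walk_pairwise_lt h a b (.inr hab)
  obtain ⟨q, hq, -⟩ := exists_walk_pairwise_lt h b r hbr
  have hs : (p.append q).support.Pairwise lt := by
    rw [SimpleGraph.Walk.support_append, List.pairwise_append]
    rw [← SimpleGraph.Walk.cons_tail_support, List.pairwise_cons] at hq
    refine ⟨hp, hq.2, fun x hx y hy => ?_⟩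
    rcases hpb x hx with rfl | hx
    · exact hq.1 y hy
    · exact h.2 _ _ _ hx (hq.1 y hy)
  refine ⟨p.append q, SimpleGraph.Walk.IsPath.mk' ?_, hs, ?_⟩
  · refine List.Pairwise.imp ?_ hs
    rintro x _ hxy rfl
    exact h.1 x hxy
  · simp

/-- In a strict order with a greatest element whose Hasse diagram is a tree,
the elements above a given one form a chain. -/
lemma lt_trichotomy_of_common_lt {V : Type*} [Finite V] {lt : V → V → Prop}
    (h : IsStrictPO lt) (htree : (hasseGraph lt).IsTree) {r : V} (hr : ∀ v, v ≠ r → lt v r)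
    {a b c : V} (hab : lt a b) (hac : lt a c) : b = c ∨ lt b c ∨ lt c b := by
  have top : ∀ v, v = r ∨ lt v r := fun v => or_iff_not_imp_left.2 (hr v)
  obtain ⟨p, hp, hps, hpb⟩ := exists_isPath_through h hab (top b)
  obtain ⟨q, hq, -, hqc⟩ := exists_isPath_through h hac (top c)
  obtain rfl : p = q := (htree.existsUnique_path a r).unique hp hq
  have : Std.Symm fun x y => x = y ∨ lt x y ∨ lt y x := ⟨by tauto⟩
  exact List.Pairwise.forall_of_forall (R := fun x y => x = y ∨ lt x y ∨ lt y x)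
    (fun x _ => .inl rfl) (hps.imp fun h => .inr (.inl h)) hpb hqc

/-- A finite forest order has a linear extension in which every down-set of an element is an
interval, and in which a prescribed up-closed chain precedes everything incomparable to it. -/
lemma exists_postorder {V : Type*} [Finite V] {lt : V → V → Prop} (h : IsStrictPO lt)
    (hchain : ∀ a b c, lt a b → lt a c → b = c ∨ lt b c ∨ lt c b)
    {r : V} (hr : ∀ v, v ≠ r → lt v r) (C : Set V) (hrC : r ∈ C)
    (hC : ∀ a ∈ C, ∀ b ∈ C, a = b ∨ lt a b ∨ lt b a)
    (hup : ∀ a ∈ C, ∀ b, lt a b → b ∈ C) :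
    ∃ L : V → V → Prop, IsStrictPO L ∧ (∀ a b, a = b ∨ L a b ∨ L b a) ∧
      (∀ a b, lt a b → L a b) ∧ (∀ a b c, lt a c → L a b → L b c → lt b c) ∧
      ∀ c ∈ C, ∀ x ∉ C, L x c → lt x c := by
  obtain ⟨hirr, htrans⟩ := h
  have : IsTrans V (Function.swap lt) := ⟨fun a b c h1 h2 => htrans c b a h2 h1⟩
  have : Std.Irrefl (Function.swap lt) := ⟨hirr⟩
  have : IsTrans V lt := ⟨htrans⟩
  have : Std.Irrefl lt := ⟨hirr⟩
  have wf : WellFounded (Function.swap lt) := Finite.wellFounded_of_trans_of_irrefl _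
  have wf' : WellFounded lt := Finite.wellFounded_of_trans_of_irrefl _
  suffices H : ∀ S : Set V, C ⊆ S → (∀ a ∈ S, ∀ b, lt a b → b ∈ S) →
      (∃ L : V → V → Prop, (∀ a ∈ S, ¬ L a a) ∧
        (∀ a ∈ S, ∀ b ∈ S, ∀ c ∈ S, L a b → L b c → L a c) ∧
        (∀ a ∈ S, ∀ b ∈ S, a = b ∨ L a b ∨ L b a) ∧
        (∀ a ∈ S, ∀ b ∈ S, lt a b → L a b) ∧
        (∀ a ∈ S, ∀ b ∈ S, ∀ c ∈ S, lt a c → L a b → L b c → lt b c) ∧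
        ∀ c ∈ C, ∀ x ∈ S, x ∉ C → L x c → lt x c) →
      ∃ L : V → V → Prop, IsStrictPO L ∧ (∀ a b, a = b ∨ L a b ∨ L b a) ∧
        (∀ a b, lt a b → L a b) ∧ (∀ a b c, lt a c → L a b → L b c → lt b c) ∧
        ∀ c ∈ C, ∀ x ∉ C, L x c → lt x c by
    refine H C subset_rfl hup ⟨lt, ?_⟩
    grind
  intro S
  induction S using (wellFounded_gt (α := Set V)).induction with
  | _ S ih =>
  rintro hCS hS ⟨L, h1, h2, h3, h4, h5, h6⟩
  by_cases hne : (Sᶜ).Nonempty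
  swap
  · have : ∀ x, x ∈ S := fun x => by_contra fun hx => hne ⟨x, hx⟩
    exact ⟨L, ⟨by grind, by grind⟩, by grind, by grind, by grind, by grind⟩
  obtain ⟨m, hm, hmax⟩ := wf.has_min _ hne
  have hm' : m ∉ S := hm
  have hmS : ∀ x, lt m x → x ∈ S := fun x hx => by_contra fun hxS => hmax x hxS hx
  obtain ⟨p, hmp, hpmin⟩ := wf'.has_min {x | lt m x} ⟨r, hr m fun e => hm' (e ▸ hCS hrC)⟩
  have hmp : lt m p := hmp
  have hpm : ∀ x, lt m x → x = p ∨ lt p x := fun x hx => by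
    have := hpmin x hx
    have := hchain m x p hx hmp
    tauto
  have hpS := hmS p hmp
  have hnlt : ∀ x ∈ S, ¬ lt x m := fun x hx hxm => hm' (hS x hx m hxm)
  have hmC : m ∉ C := fun hx => hm' (hCS hx)
  have key := ih (insert m S) (Set.ssubset_insert hm') (hCS.trans (Set.subset_insert _ _))
  clear ih
  refine key ?_
    ⟨fun a b => (a = m ∧ b ≠ m ∧ (b = p ∨ L p b)) ∨ (a ≠ m ∧ b = m ∧ L a p) ∨
      (a ≠ m ∧ b ≠ m ∧ L a b), ?_, ?_, ?_, ?_, ?_, ?_⟩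
  · grind
  · grind
  · simp only [Set.mem_insert_iff]
    clear key h4 h5 h6 hC hchain hup
    rintro a (rfl | ha) b (rfl | hb) c (rfl | hc)
    all_goals grind
  · simp only [Set.mem_insert_iff]
    clear key h2 h4 h5 h6 hC hchain
    rintro a (rfl | ha) b (rfl | hb)
    · grind
    · have := h3 b hb p hpS
      grind
    · have := h3 a ha p hpS
      grind
    · have := h3 a ha b hb
      grind
  · simp only [Set.mem_insert_iff]
    clear key h5 h6 hC hchain
    rintro a (rfl | ha) b (rfl | hb)
    · grind
    · have := hpm b
      have := h4 p hpS b hb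
      grind
    · grind
    · grind
  · simp only [Set.mem_insert_iff]
    clear key h6 hC hchain hup h3
    rintro a (rfl | ha) b (rfl | hb) c (rfl | hc)
    all_goals grind
  · simp only [Set.mem_insert_iff]
    clear key h5 hchain h3
    intro c hc x hx hxC hxc
    rcases hx with rfl | hx
    · have := hC p
      have := h4 c (hCS hc) p hpS
      have := h6 c hc p hpS
      have := hCS hc
      grind
    · grind

lemma exists_pairwise_list {V : Type*} {R : V → V → Prop} (h : IsStrictPO R)
    (htri : ∀ a b, a = b ∨ R a b ∨ R b a) (s : Finset V) :
    ∃ l : List V, l.Nodup ∧ (∀ x, x ∈ l ↔ x ∈ s) ∧ l.Pairwise R := by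
  classical
  obtain ⟨hirr, htrans⟩ := h
  let le : V → V → Prop := fun a b => a = b ∨ R a b
  have : IsTrans V le := ⟨by grind⟩
  have : Std.Total le := ⟨by grind⟩
  have hnd : (s.toList.insertionSort le).Nodup :=
    (List.perm_insertionSort le _).nodup_iff.2 s.nodup_toList
  refine ⟨s.toList.insertionSort le, hnd, fun x => ?_, ?_⟩
  · rw [(List.perm_insertionSort le _).mem_iff, Finset.mem_toList]
  · exact ((List.pairwise_insertionSort le _).and hnd).imp fun ⟨h, hn⟩ => h.resolve_left hn

lemma filter_eq_of_pairwise {V : Type*} {R : V → V → Prop} (h : IsStrictPO R) {l l' : List V}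
    (hnd : l.Nodup) (hl : l.Pairwise R) (hl' : l'.Pairwise R) (p : V → Bool)
    (hmem : ∀ x, x ∈ l' ↔ x ∈ l ∧ p x = true) : l.filter p = l' := by
  have hnd' : l'.Nodup := by
    refine List.Pairwise.imp ?_ hl'
    rintro x _ hxy rfl
    exact h.1 x hxy
  refine List.Perm.eq_of_pairwise (le := R) (fun a b _ _ hab hba => ?_) (hl.filter _) hl' ?_
  · exact (h.1 a (h.2 _ _ _ hab hba)).elim
  · exact (List.perm_ext_iff_of_nodup (hnd.filter _) hnd').2 fun x => by
      rw [List.mem_filter, hmem]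

lemma alternates_iff_isChain {V : Type*} [DecidableEq V] (w : List V) (a b : V) :
    Alternates w a b ↔ (w.filter (fun x => decide (x = a ∨ x = b))).IsChain (· ≠ ·) :=
  Iff.rfl

lemma alternates_comm {V : Type*} [DecidableEq V] (w : List V) (a b : V) :
    Alternates w a b ↔ Alternates w b a := by
  simp only [Alternates, or_comm]

/-- Let `G` be an arborescence with a treelike orientation `lt` whose greatest
element is `r`, and let `C` be a maximum clique of `G` containing `r`.  Then there
are words `w1` and `w2` such that `w1 r w2` represents `G`, every vertex of `C`
occurs exactly once in `w1 r w2` (those of `C \ {r}` occurring in `w1`), and every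
vertex outside `C` occurs exactly once in `w1` and exactly once in `w2`. -/
theorem arborescence_word_construction
    {V : Type*} [Fintype V] [DecidableEq V] (G : SimpleGraph V)
    (lt : V → V → Prop) (hlt : IsTreelikeOrientation G lt)
    (r : V) (hr : ∀ v : V, v ≠ r → lt v r)
    (C : Finset V) (hC : G.IsClique (C : Set V)) (hrC : r ∈ C)
    (hmax : ∀ D : Finset V, G.IsClique (D : Set V) → D.card ≤ C.card) :
    ∃ w1 w2 : List V,
      Represents G (w1 ++ r :: w2) ∧
      (∀ v ∈ C, v ≠ r → w1.count v = 1 ∧ w2.count v = 0) ∧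
      r ∉ w1 ∧ r ∉ w2 ∧
      (∀ v : V, v ∉ C → w1.count v = 1 ∧ w2.count v = 1) := by
  classical
  obtain ⟨hpo, hadj, htree⟩ := hlt
  have hchain : ∀ a b c, lt a b → lt a c → b = c ∨ lt b c ∨ lt c b :=
    fun a b c => lt_trichotomy_of_common_lt hpo htree hr
  have hCC : ∀ a ∈ C, ∀ b ∈ C, a = b ∨ lt a b ∨ lt b a := fun a ha b hb =>
    or_iff_not_imp_left.2 fun hne => (hadj a b).1 (hC ha hb hne)
  have hup : ∀ a ∈ C, ∀ b, lt a b → b ∈ C := by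
    intro a ha b hab
    by_contra hb
    have hD := hmax (insert b C) (by
      rw [Finset.coe_insert, SimpleGraph.isClique_insert]
      refine ⟨hC, fun c hc hbc => (hadj b c).2 ?_⟩
      rcases hCC a ha c hc with rfl | hac | hca
      · exact .inr hab
      · exact (hchain a b c hab hac).resolve_left hbc
      · exact .inr (hpo.2 _ _ _ hca hab))
    rw [Finset.card_insert_of_notMem hb] at hD
    omega
  obtain ⟨L, hL, hLtri, hltL, h_interval, hCL⟩ :=
    exists_postorder hpo hchain hr (C : Set V) hrC hCC hup
  obtain ⟨hirr, htrans⟩ := hpo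
  let M : V → V → Prop := fun a b => lt a b ∨ (¬ lt a b ∧ ¬ lt b a ∧ L b a)
  have hM : IsStrictPO M := by
    obtain ⟨L1, L2⟩ := hL
    refine ⟨by grind, fun a b c hab hbc => ?_⟩
    have := hLtri a b
    have := hLtri a c
    have := hLtri b c
    grind
  have hMtri : ∀ a b, a = b ∨ M a b ∨ M b a := fun a b => by
    have := hLtri a b
    grind
  obtain ⟨w1, hnd1, hmem1, hs1⟩ := exists_pairwise_list hL hLtri (Finset.univ.erase r)
  obtain ⟨w2, hnd2, hmem2, hs2⟩ := exists_pairwise_list hM hMtri Cᶜ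
  simp only [Finset.mem_erase, Finset.mem_univ, and_true, Finset.mem_compl] at hmem1 hmem2
  refine ⟨w1, w2, ⟨fun v => ?_, ?_⟩, fun v hv hvr => ⟨?_, ?_⟩, ?_, ?_, fun v hv => ⟨?_, ?_⟩⟩
  · by_cases hv : v = r <;> simp [hv, hmem1]
  · have key : ∀ a b, L a b → (G.Adj a b ↔ Alternates (w1 ++ r :: w2) a b) := by
      intro a b hab
      have hne : a ≠ b := fun e => hL.1 b (e ▸ hab)
      have har : a ≠ r := fun e => hL.1 r (hL.2 _ _ _ (e ▸ hab) (
        hltL b r (hr b fun e' => hne (e.trans e'.symm))))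
      have hba : ¬ lt b a := fun hba => hL.1 a (hL.2 _ _ _ hab (hltL _ _ hba))
      have f1 := fun l' hl' => filter_eq_of_pairwise (l' := l') hL hnd1 hs1 hl'
        (fun x => decide (x = a ∨ x = b))
      have f2 := fun l' hl' => filter_eq_of_pairwise (l' := l') hM hnd2 hs2 hl'
        (fun x => decide (x = a ∨ x = b))
      rw [hadj, alternates_iff_isChain, List.filter_append, List.filter_cons]
      by_cases hbr : b = r
      · subst hbr
        rw [f1 [a] (by simp) (by grind)]
        by_cases haC : a ∈ C
        · rw [f2 [] (by simp) (by grind)]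
          simp [har, hr]
        · rw [f2 [a] (by simp) (by grind)]
          simp [har, hr, Ne.symm har]
      rw [f1 [a, b] (by simpa using hab) (by grind)]
      by_cases haC : a ∈ C <;> by_cases hbC : b ∈ C
      · rw [f2 [] (by simp) (by grind)]
        have := hCC a haC b hbC
        simp [Ne.symm har, Ne.symm hbr, hne]
        tauto
      · rw [f2 [b] (by simp) (by grind)]
        have := fun h => hbC (hup a haC b h)
        simp [Ne.symm har, Ne.symm hbr, hne]
        tauto
      · rw [f2 [a] (by simp) (by grind)]
        have := hCL b hbC a haC hab
        simp [Ne.symm har, Ne.symm hbr, hne, Ne.symm hne, this]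
      · by_cases hlt : lt a b
        · rw [f2 [a, b] (by simp [M, hlt]) (by grind)]
          simp [Ne.symm har, Ne.symm hbr, hne, Ne.symm hne, hlt]
        · rw [f2 [b, a] (by simp [M, hlt, hba, hab]) (by grind)]
          simp [Ne.symm har, Ne.symm hbr, hne, hlt, hba]
    intro a b hne
    rcases (hLtri a b).resolve_left hne with hab | hab
    · exact key a b hab
    · rw [SimpleGraph.adj_comm, alternates_comm]
      exact key b a hab
  · exact List.count_eq_one_of_mem hnd1 ((hmem1 v).2 hvr)
  · exact List.count_eq_zero_of_not_mem fun h => (hmem2 v).1 h hv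
  · exact fun h => (hmem1 r).1 h rfl
  · exact fun h => (hmem2 r).1 h hrC
  · exact List.count_eq_one_of_mem hnd1 ((hmem1 v).2 fun e => hv (e ▸ hrC))
  · exact List.count_eq_one_of_mem hnd2 ((hmem2 v).2 hv)
end
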